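/- Let K = ℤ be the tropical semifield, let n ∈ ℕ, and fix i ∈ ℐ. The set of a ∈ ℕ^ν such that the equivalence class of (i,a) belongs to 𝒰_ℕ^n (that is, every pair (i'',a'') equivalent to (i,a) has a'' ∈ ℕ^ν and a''_1 ≤ n) has cardinality at most (n+1)(2n+1)(4n+1)⋯(2^{ν-1}n+1) = Π_{k=1}^{ν}(2^{k-1}n+1). -/

import Mathlib

open scoped BigOperators

namespace Lusztig

variable {I : Type*} [Fintype I] [DecidableEq I]

/-- A simply laced Cartan matrix: symmetric, positive definite, integer entries,
`2` on the diagonal and `0` or `-1` off the diagonal. -/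
structure IsSimplyLacedCartan (A : Matrix I I ℤ) : Prop where
  symm : ∀ i j, A i j = A j i
  posDef : ∀ x : I → ℤ, x ≠ 0 → 0 < ∑ i, ∑ j, x i * A i j * x j
  diag : ∀ i, A i i = 2
  offDiag : ∀ i j, i ≠ j → A i j = 0 ∨ A i j = -1

/-- The simple reflection `s_i` acting on `ℤ[I] = I → ℤ`, `s_i(j') = j' - a_{ij} i'`. -/
def sE (A : Matrix I I ℤ) (i : I) : Function.End (I → ℤ) :=
  fun x => x - (∑ j, A i j * x j) • Pi.single i 1

/-- The length of `w`: the least `n` such that `w` is a product of `n` simple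
reflections (`∞` convention: `sInf ∅ = 0`). -/
noncomputable def len (A : Matrix I I ℤ) (w : Function.End (I → ℤ)) : ℕ :=
  sInf {n | ∃ l : List I, l.length = n ∧ (l.map (sE A)).prod = w}

/-- `w₀` is the longest element of `W = ⟨s_i⟩` and `ν = |w₀|`. -/
structure IsLongest (A : Matrix I I ℤ) (w₀ : Function.End (I → ℤ)) (ν : ℕ) : Prop where
  mem : ∃ l : List I, (l.map (sE A)).prod = w₀
  len_eq : len A w₀ = ν
  longest : ∀ w : Function.End (I → ℤ),
    (∃ l : List I, (l.map (sE A)).prod = w) → len A w ≤ ν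

/-- `ℐ`: the set of sequences `(i_1, …, i_ν)` with `s_{i_1} ⋯ s_{i_ν} = w₀`. -/
def RedWord (A : Matrix I I ℤ) (w₀ : Function.End (I → ℤ)) (ν : ℕ) :
    Set (Fin ν → I) :=
  {f | ((List.ofFn f).map (sE A)).prod = w₀}

/-- The coefficient `r_{h,k}` defined by
`s_{i_1} ⋯ s_{i_{k-1}} (i_k') = Σ_h r_{h,k} h'` (here `k` is `0`-indexed). -/
def rCoef (A : Matrix I I ℤ) {ν : ℕ} (f : Fin ν → I) (h : I) (k : Fin ν) : ℤ :=
  ((List.ofFn fun m : Fin (k : ℕ) => sE A (f (Fin.castLE k.2.le m))).prod :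
    Function.End (I → ℤ)) (Pi.single (f k) 1) h

/-- `‖i,a‖_h = Π_k a_k^{r_{h,k}}`. -/
def normAt (A : Matrix I I ℤ) {ν : ℕ} {K : Type*} [CommGroup K]
    (f : Fin ν → I) (a : Fin ν → K) (h : I) : K :=
  ∏ k : Fin ν, a k ^ rCoef A f h k

section Semifield

variable {K : Type*} [CommGroup K] [AddCommSemigroup K]

/-- Adjacency of two pairs in `ℐ × K^ν`, for a semifield `K` (written
multiplicatively, with addition `+`). -/
def Adjacent (A : Matrix I I ℤ) (w₀ : Function.End (I → ℤ)) (ν : ℕ)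
    (p q : (Fin ν → I) × (Fin ν → K)) : Prop :=
  p.1 ∈ RedWord A w₀ ν ∧ q.1 ∈ RedWord A w₀ ν ∧
  ((∃ (l : ℕ) (h0 : l < ν) (h1 : l + 1 < ν) (h2 : l + 2 < ν),
      A (p.1 ⟨l, h0⟩) (p.1 ⟨l + 1, h1⟩) = -1 ∧
      p.1 ⟨l + 2, h2⟩ = p.1 ⟨l, h0⟩ ∧
      q.1 ⟨l, h0⟩ = p.1 ⟨l + 1, h1⟩ ∧ q.1 ⟨l + 1, h1⟩ = p.1 ⟨l, h0⟩ ∧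
      q.1 ⟨l + 2, h2⟩ = p.1 ⟨l + 1, h1⟩ ∧
      (∀ k : Fin ν, (k : ℕ) ≠ l → (k : ℕ) ≠ l + 1 → (k : ℕ) ≠ l + 2 →
        q.1 k = p.1 k ∧ q.2 k = p.2 k) ∧
      q.2 ⟨l, h0⟩ =
        p.2 ⟨l + 1, h1⟩ * p.2 ⟨l + 2, h2⟩ * (p.2 ⟨l, h0⟩ + p.2 ⟨l + 2, h2⟩)⁻¹ ∧
      q.2 ⟨l + 1, h1⟩ = p.2 ⟨l, h0⟩ + p.2 ⟨l + 2, h2⟩ ∧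
      q.2 ⟨l + 2, h2⟩ =
        p.2 ⟨l, h0⟩ * p.2 ⟨l + 1, h1⟩ * (p.2 ⟨l, h0⟩ + p.2 ⟨l + 2, h2⟩)⁻¹) ∨
   (∃ (l : ℕ) (h0 : l < ν) (h1 : l + 1 < ν),
      A (p.1 ⟨l, h0⟩) (p.1 ⟨l + 1, h1⟩) = 0 ∧
      q.1 ⟨l, h0⟩ = p.1 ⟨l + 1, h1⟩ ∧ q.1 ⟨l + 1, h1⟩ = p.1 ⟨l, h0⟩ ∧
      (∀ k : Fin ν, (k : ℕ) ≠ l → (k : ℕ) ≠ l + 1 →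
        q.1 k = p.1 k ∧ q.2 k = p.2 k) ∧
      q.2 ⟨l, h0⟩ = p.2 ⟨l + 1, h1⟩ ∧ q.2 ⟨l + 1, h1⟩ = p.2 ⟨l, h0⟩))

end Semifield

/-- Adjacency of two pairs in `ℐ × ℤ^ν` for the tropical semifield `ℤ`
(sum = `min`, product = `+`). -/
def TAdjacent (A : Matrix I I ℤ) (w₀ : Function.End (I → ℤ)) (ν : ℕ)
    (p q : (Fin ν → I) × (Fin ν → ℤ)) : Prop :=
  p.1 ∈ RedWord A w₀ ν ∧ q.1 ∈ RedWord A w₀ ν ∧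
  ((∃ (l : ℕ) (h0 : l < ν) (h1 : l + 1 < ν) (h2 : l + 2 < ν),
      A (p.1 ⟨l, h0⟩) (p.1 ⟨l + 1, h1⟩) = -1 ∧
      p.1 ⟨l + 2, h2⟩ = p.1 ⟨l, h0⟩ ∧
      q.1 ⟨l, h0⟩ = p.1 ⟨l + 1, h1⟩ ∧ q.1 ⟨l + 1, h1⟩ = p.1 ⟨l, h0⟩ ∧
      q.1 ⟨l + 2, h2⟩ = p.1 ⟨l + 1, h1⟩ ∧
      (∀ k : Fin ν, (k : ℕ) ≠ l → (k : ℕ) ≠ l + 1 → (k : ℕ) ≠ l + 2 →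
        q.1 k = p.1 k ∧ q.2 k = p.2 k) ∧
      q.2 ⟨l, h0⟩ =
        p.2 ⟨l + 1, h1⟩ + p.2 ⟨l + 2, h2⟩ - min (p.2 ⟨l, h0⟩) (p.2 ⟨l + 2, h2⟩) ∧
      q.2 ⟨l + 1, h1⟩ = min (p.2 ⟨l, h0⟩) (p.2 ⟨l + 2, h2⟩) ∧
      q.2 ⟨l + 2, h2⟩ =
        p.2 ⟨l, h0⟩ + p.2 ⟨l + 1, h1⟩ - min (p.2 ⟨l, h0⟩) (p.2 ⟨l + 2, h2⟩)) ∨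
   (∃ (l : ℕ) (h0 : l < ν) (h1 : l + 1 < ν),
      A (p.1 ⟨l, h0⟩) (p.1 ⟨l + 1, h1⟩) = 0 ∧
      q.1 ⟨l, h0⟩ = p.1 ⟨l + 1, h1⟩ ∧ q.1 ⟨l + 1, h1⟩ = p.1 ⟨l, h0⟩ ∧
      (∀ k : Fin ν, (k : ℕ) ≠ l → (k : ℕ) ≠ l + 1 →
        q.1 k = p.1 k ∧ q.2 k = p.2 k) ∧
      q.2 ⟨l, h0⟩ = p.2 ⟨l + 1, h1⟩ ∧ q.2 ⟨l + 1, h1⟩ = p.2 ⟨l, h0⟩))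

set_option linter.unusedSectionVars false

section RootSystem

open Matrix

variable {I : Type*} [Fintype I] [DecidableEq I] {A : Matrix I I ℤ}

/-- The bilinear form on `ℤ[I]` with Gram matrix `A`. -/
def form (A : Matrix I I ℤ) (x y : I → ℤ) : ℤ := x ⬝ᵥ A *ᵥ y

/-- The simple root `i'`, as an element of `I → ℤ`. -/
def simpleRoot (i : I) : I → ℤ := Pi.single i 1

lemma sE_eq (i : I) (x : I → ℤ) :
    sE A i x = x - form A (simpleRoot i) x • simpleRoot i := by
  simp only [form, simpleRoot, single_one_dotProduct]
  rfl

lemma form_simple_simple (i j : I) : form A (simpleRoot i) (simpleRoot j) = A i j := by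
  simp [form, simpleRoot]

lemma form_sub_left (x y z : I → ℤ) : form A (x - y) z = form A x z - form A y z := by
  simp [form, sub_dotProduct]

lemma form_sub_right (x y z : I → ℤ) : form A x (y - z) = form A x y - form A x z := by
  simp [form, mulVec_sub, dotProduct_sub]

lemma form_smul_left (c : ℤ) (x y : I → ℤ) : form A (c • x) y = c * form A x y := by
  simp only [form, smul_dotProduct, smul_eq_mul]

lemma form_smul_right (c : ℤ) (x y : I → ℤ) : form A x (c • y) = c * form A x y := by
  simp only [form, mulVec_smul, dotProduct_smul, smul_eq_mul]

lemma form_eq_sum (x y : I → ℤ) : form A x y = ∑ i, ∑ j, x i * A i j * y j := by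
  simp [form, dotProduct, mulVec, Finset.mul_sum, mul_assoc]

/-- The simple reflection as a linear map. -/
def reflection (A : Matrix I I ℤ) (i : I) : Module.End ℤ (I → ℤ) where
  toFun := sE A i
  map_add' x y := by
    simp only [sE_eq, form, mulVec_add, dotProduct_add, add_smul]
    abel
  map_smul' c x := by
    simp only [sE_eq, form_smul_right, RingHom.id_apply, smul_sub, mul_smul]

/-- The linear map `s_{i_1} ⋯ s_{i_m}` attached to a word. -/
def act (A : Matrix I I ℤ) (l : List I) : Module.End ℤ (I → ℤ) :=
  (l.map (reflection A)).prod

lemma prod_map_sE_apply (l : List I) (x : I → ℤ) : (l.map (sE A)).prod x = act A l x := by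
  induction l with
  | nil => rfl
  | cons i t ih =>
    have h : ((i :: t).map (sE A)).prod x = sE A i ((t.map (sE A)).prod x) := by
      rw [List.map_cons, List.prod_cons]; rfl
    rw [h, ih, act, act, List.map_cons, List.prod_cons]
    rfl

lemma prod_map_sE_eq_iff (l l' : List I) :
    (l.map (sE A)).prod = (l'.map (sE A)).prod ↔ act A l = act A l' := by
  constructor
  · intro h
    ext1 i
    ext1
    simp only [LinearMap.comp_apply, ← prod_map_sE_apply, h]
  · intro h
    funext x
    rw [prod_map_sE_apply, prod_map_sE_apply, h]

@[simp] lemma act_nil : act A [] = 1 := rfl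

@[simp] lemma act_cons (i : I) (l : List I) : act A (i :: l) = reflection A i * act A l := by
  simp [act]

@[simp] lemma act_append (l l' : List I) : act A (l ++ l') = act A l * act A l' := by
  simp [act]

lemma reflection_apply (i : I) (x : I → ℤ) :
    reflection A i x = x - form A (simpleRoot i) x • simpleRoot i := sE_eq i x

lemma reflection_simple (i j : I) :
    reflection A i (simpleRoot j) = simpleRoot j - A i j • simpleRoot i := by
  rw [reflection_apply, form_simple_simple]

lemma reflection_apply_ne {i k : I} (h : k ≠ i) (x : I → ℤ) :
    reflection A i x k = x k := by
  simp [reflection_apply, simpleRoot, h]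

namespace IsSimplyLacedCartan


lemma form_comm (hA : IsSimplyLacedCartan A) (x y : I → ℤ) : form A x y = form A y x := by
  rw [form_eq_sum, form_eq_sum, Finset.sum_comm]
  refine Finset.sum_congr rfl fun i _ => Finset.sum_congr rfl fun j _ => ?_
  rw [hA.symm]; ring

lemma reflection_simple_self (hA : IsSimplyLacedCartan A) (i : I) :
    reflection A i (simpleRoot i) = - simpleRoot i := by
  rw [reflection_simple, hA.diag]; module

lemma reflection_mul_self (hA : IsSimplyLacedCartan A) (i : I) :
    reflection A i * reflection A i = 1 := by
  refine LinearMap.ext fun x => ?_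
  simp only [Module.End.mul_apply, Module.End.one_apply, reflection_apply, form_sub_right,
    form_smul_right, form_simple_simple, hA.diag]
  module

lemma reflection_reflection (hA : IsSimplyLacedCartan A) (i : I) (x : I → ℤ) :
    reflection A i (reflection A i x) = x :=
  LinearMap.congr_fun (hA.reflection_mul_self i) x

lemma reflection_comm (hA : IsSimplyLacedCartan A) {i j : I} (h : A i j = 0) :
    reflection A i * reflection A j = reflection A j * reflection A i := by
  have h' : A j i = 0 := by rw [hA.symm, h]
  refine LinearMap.ext fun x => ?_
  simp only [Module.End.mul_apply, reflection_apply, form_sub_right,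
    form_smul_right, form_simple_simple, h, h']
  module

lemma reflection_braid (hA : IsSimplyLacedCartan A) {i j : I} (h : A i j = -1) :
    reflection A i * (reflection A j * reflection A i) =
      reflection A j * (reflection A i * reflection A j) := by
  have h' : A j i = -1 := by rw [hA.symm, h]
  refine LinearMap.ext fun x => ?_
  simp only [Module.End.mul_apply, reflection_apply, form_sub_right,
    form_smul_right, form_simple_simple, h, h', hA.diag]
  module

lemma form_reflection (hA : IsSimplyLacedCartan A) (i : I) (x y : I → ℤ) :
    form A (reflection A i x) (reflection A i y) = form A x y := by
  simp only [reflection_apply, form_sub_right, form_sub_left, form_smul_left,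
    form_smul_right, form_simple_simple, hA.diag, hA.form_comm x (simpleRoot i)]
  ring

lemma form_act (hA : IsSimplyLacedCartan A) (l : List I) (x y : I → ℤ) :
    form A (act A l x) (act A l y) = form A x y := by
  induction l with
  | nil => rfl
  | cons i t ih => simp [hA.form_reflection, ih]

lemma even_form_self (hA : IsSimplyLacedCartan A) (x : I → ℤ) : Even (form A x x) := by
  rw [← ZMod.intCast_eq_zero_iff_even, form_eq_sum, ← Finset.sum_product']
  push_cast
  refine Finset.sum_involution (fun p _ => (p.2, p.1)) ?_ ?_ (by simp) (by simp)
  · rintro ⟨i, j⟩ -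
    simp only [hA.symm j i]
    rw [mul_right_comm, mul_right_comm (x j : ZMod 2), mul_comm (x j : ZMod 2)]
    exact CharTwo.add_self_eq_zero _
  · rintro ⟨i, j⟩ - h0 h
    obtain rfl : j = i := by simpa using (Prod.ext_iff.1 h).1
    apply h0
    simp only [hA.diag]
    rw [show ((2 : ℤ) : ZMod 2) = 0 from rfl]
    simp

lemma form_self_pos (hA : IsSimplyLacedCartan A) {x : I → ℤ} (hx : x ≠ 0) : 0 < form A x x := by
  rw [form_eq_sum]; exact hA.posDef x hx

lemma two_le_form_self (hA : IsSimplyLacedCartan A) {x : I → ℤ} (hx : x ≠ 0) :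
    2 ≤ form A x x := by
  have h := hA.form_self_pos hx
  obtain ⟨c, hc⟩ := hA.even_form_self x
  omega

/-- A root has either only nonnegative or only nonpositive coordinates. -/
lemma nonneg_or_nonpos (hA : IsSimplyLacedCartan A) {x : I → ℤ} (hx : form A x x = 2) :
    0 ≤ x ∨ x ≤ 0 := by
  by_contra! hcon
  have hp : x⁺ ≠ 0 := fun h => hcon.2 (posPart_eq_zero.1 h)
  have hn : x⁻ ≠ 0 := fun h => hcon.1 (negPart_eq_zero.1 h)
  have h1 := hA.two_le_form_self hp
  have h2 := hA.two_le_form_self hn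
  have h3 : form A x⁺ x⁻ ≤ 0 := by
    rw [form_eq_sum]
    refine Finset.sum_nonpos fun i _ => Finset.sum_nonpos fun j _ => ?_
    have hi : 0 ≤ x⁺ i := posPart_nonneg x i
    have hj : 0 ≤ x⁻ j := negPart_nonneg x j
    rcases eq_or_ne i j with rfl | hij
    · have : x⁺ i * x⁻ i = 0 := by
        simp only [Pi.posPart_apply, Pi.negPart_apply]
        rcases le_total 0 (x i) with h | h
        · rw [negPart_eq_zero.2 h, mul_zero]
        · rw [posPart_eq_zero.2 h, zero_mul]
      rw [mul_right_comm, this, zero_mul]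
    · rcases hA.offDiag i j hij with h | h <;> rw [h] <;> nlinarith [mul_nonneg hi hj]
  have h4 : form A x x = form A x⁺ x⁺ + form A x⁻ x⁻ - 2 * form A x⁺ x⁻ := by
    conv_lhs => rw [← posPart_sub_negPart x]
    simp only [form_sub_left, form_sub_right, hA.form_comm x⁻ x⁺]
    ring
  omega

lemma eq_simpleRoot (hA : IsSimplyLacedCartan A) {x : I → ℤ} (hx : form A x x = 2)
    (h0 : 0 ≤ x) {i : I} (hi : ¬ 0 ≤ reflection A i x) : x = simpleRoot i := by
  have hr : form A (reflection A i x) (reflection A i x) = 2 := by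
    rw [hA.form_reflection, hx]
  have hneg := (hA.nonneg_or_nonpos hr).resolve_left hi
  have hxi : x = x i • simpleRoot i := by
    funext k
    by_cases hk : k = i
    · subst hk; simp [simpleRoot]
    · have h1 := hneg k
      rw [reflection_apply_ne hk] at h1
      have h2 := h0 k
      simp only [Pi.zero_apply] at h1 h2
      simp [simpleRoot, hk]; omega
  rw [hxi, form_smul_left, form_smul_right, form_simple_simple, hA.diag] at hx
  have h1 : x i = 1 := by
    have := h0 i
    simp only [Pi.zero_apply] at this
    nlinarith
  rw [hxi, h1, one_smul]

/-- The exchange property. -/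
lemma exists_act_eq_mul (hA : IsSimplyLacedCartan A) (j : I) (l : List I)
    (h : ¬ 0 ≤ act A l (simpleRoot j)) :
    ∃ l' : List I, l'.length + 1 = l.length ∧ act A l = act A (l' ++ [j]) := by
  induction l with
  | nil =>
    refine absurd ?_ h
    simp [simpleRoot]
  | cons i t ih =>
    by_cases ht : 0 ≤ act A t (simpleRoot j)
    · have hroot : form A (act A t (simpleRoot j)) (act A t (simpleRoot j)) = 2 := by
        rw [hA.form_act, form_simple_simple, hA.diag]
      have heq := hA.eq_simpleRoot hroot ht (i := i) (by simpa using h)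
      refine ⟨t, by simp, ?_⟩
      refine LinearMap.ext fun y => ?_
      have hy := hA.form_act t (simpleRoot j) y
      simp only [act_cons, act_append, act_nil, mul_one, Module.End.mul_apply, reflection_apply,
        map_sub, map_smul, ← hy, heq]
    · obtain ⟨t', hlen, hact⟩ := ih ht
      exact ⟨i :: t', by simp [hlen], by simp [hact]⟩

lemma act_reverse_mul (hA : IsSimplyLacedCartan A) (l : List I) :
    act A l.reverse * act A l = 1 := by
  induction l with
  | nil => simp
  | cons i t ih =>
    simp only [List.reverse_cons, act_append, act_cons, act_nil, mul_one]
    rw [mul_assoc, ← mul_assoc (reflection A i), hA.reflection_mul_self, one_mul, ih]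

lemma act_mul_reverse (hA : IsSimplyLacedCartan A) (l : List I) :
    act A l * act A l.reverse = 1 := by
  simpa using hA.act_reverse_mul l.reverse

lemma act_reverse_congr (hA : IsSimplyLacedCartan A) {l l' : List I} (h : act A l = act A l') :
    act A l.reverse = act A l'.reverse := by
  have h1 := hA.act_mul_reverse l
  calc act A l.reverse = act A l'.reverse * (act A l' * act A l.reverse) := by
        rw [← mul_assoc, hA.act_reverse_mul, one_mul]
    _ = act A l'.reverse := by rw [← h, h1, mul_one]

lemma form_act_simple (hA : IsSimplyLacedCartan A) (l : List I) (j : I) :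
    form A (act A l (simpleRoot j)) (act A l (simpleRoot j)) = 2 := by
  rw [hA.form_act, form_simple_simple, hA.diag]

lemma act_simple_not_nonneg_iff (hA : IsSimplyLacedCartan A) (l : List I) (j : I) :
    ¬ 0 ≤ act A l (simpleRoot j) ↔ act A l (simpleRoot j) ≤ 0 := by
  have h2 := hA.form_act_simple l j
  refine ⟨(hA.nonneg_or_nonpos h2).resolve_left, fun h h' => ?_⟩
  rw [le_antisymm h h'] at h2
  simp [form] at h2

lemma act_append_simple_self (hA : IsSimplyLacedCartan A) (l : List I) (j : I) :
    act A (l ++ [j]) (simpleRoot j) = - act A l (simpleRoot j) := by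
  simp [hA.reflection_simple_self]

lemma act_append_append_self (hA : IsSimplyLacedCartan A) (l : List I) (j : I) :
    act A (l ++ [j] ++ [j]) = act A l := by
  simp [hA.reflection_mul_self]

lemma act_append_singleton_inj (hA : IsSimplyLacedCartan A) {l l' : List I} {j : I}
    (h : act A (l ++ [j]) = act A (l' ++ [j])) : act A l = act A l' := by
  rw [← hA.act_append_append_self l j, ← hA.act_append_append_self l' j, act_append, h,
    ← act_append]

end IsSimplyLacedCartan

/-- A word is reduced if no shorter word represents the same Weyl group element. -/
def IsReducedWord (A : Matrix I I ℤ) (l : List I) : Prop :=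
  ∀ l' : List I, act A l' = act A l → l.length ≤ l'.length

namespace IsReducedWord

lemma of_append_left {l l' : List I} (h : IsReducedWord A (l ++ l')) : IsReducedWord A l := by
  intro m hm
  have := h (m ++ l') (by rw [act_append, act_append, hm])
  simpa using this

lemma of_append_right {l l' : List I} (h : IsReducedWord A (l ++ l')) : IsReducedWord A l' := by
  intro m hm
  have := h (l ++ m) (by rw [act_append, act_append, hm])
  simpa using this

lemma congr {l l' : List I} (h : IsReducedWord A l) (hl : act A l' = act A l)
    (hlen : l'.length = l.length) : IsReducedWord A l' := fun m hm => by
  rw [hlen]; exact h m (hm.trans hl)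

lemma nonneg (hA : IsSimplyLacedCartan A) {l : List I} {j : I}
    (h : IsReducedWord A (l ++ [j])) : 0 ≤ act A l (simpleRoot j) := by
  by_contra hneg
  obtain ⟨l', hlen, hact⟩ := hA.exists_act_eq_mul j l hneg
  have := h l' (by rw [act_append, hact, ← act_append, hA.act_append_append_self])
  simp at this
  omega

lemma nonpos (hA : IsSimplyLacedCartan A) {l : List I} {j : I}
    (h : IsReducedWord A (l ++ [j])) : act A (l ++ [j]) (simpleRoot j) ≤ 0 := by
  rw [hA.act_append_simple_self]
  simpa using h.nonneg hA

lemma append_singleton (hA : IsSimplyLacedCartan A) {l : List I} {j : I}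
    (h : IsReducedWord A l) (hj : 0 ≤ act A l (simpleRoot j)) : IsReducedWord A (l ++ [j]) := by
  intro m hm
  by_contra! hlt
  have hneg : ¬ 0 ≤ act A m (simpleRoot j) := by
    rw [hA.act_simple_not_nonneg_iff, hm, hA.act_append_simple_self]
    simpa using hj
  obtain ⟨m', hlen, hact⟩ := hA.exists_act_eq_mul j m hneg
  have := h m' (hA.act_append_singleton_inj (hact.symm.trans hm))
  simp at hlt
  omega

lemma reverse (hA : IsSimplyLacedCartan A) {l : List I} (h : IsReducedWord A l) :
    IsReducedWord A l.reverse := by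
  intro m hm
  have := h m.reverse (by simpa using hA.act_reverse_congr hm)
  simpa using this

/-- Exchange at the end of a reduced word. -/
lemma exists_append_singleton (hA : IsSimplyLacedCartan A) {l : List I} {j : I}
    (h : IsReducedWord A l) (hj : act A l (simpleRoot j) ≤ 0) :
    ∃ m : List I, (m ++ [j]).length = l.length ∧ act A (m ++ [j]) = act A l ∧
      IsReducedWord A (m ++ [j]) := by
  obtain ⟨m, hlen, hact⟩ :=
    hA.exists_act_eq_mul j l ((hA.act_simple_not_nonneg_iff l j).2 hj)
  have hlen' : (m ++ [j]).length = l.length := by simpa using hlen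
  exact ⟨m, hlen', hact.symm, h.congr hact.symm hlen'⟩

end IsReducedWord

/-- A single (commutation or braid) move on a decorated word, with the tropical transformation
of the decorations. -/
inductive Move (A : Matrix I I ℤ) : List (I × ℤ) → List (I × ℤ) → Prop
  | comm (u v : List (I × ℤ)) (i j : I) (a b : ℤ) (h : A i j = 0) :
      Move A (u ++ [(i, a), (j, b)] ++ v) (u ++ [(j, b), (i, a)] ++ v)
  | braid (u v : List (I × ℤ)) (i j : I) (a b c : ℤ) (h : A i j = -1) :
      Move A (u ++ [(i, a), (j, b), (i, c)] ++ v)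
        (u ++ [(j, b + c - min a c), (i, min a c), (j, a + b - min a c)] ++ v)

/-- Decorated words connected by a sequence of moves. -/
abbrev Moves (A : Matrix I I ℤ) : List (I × ℤ) → List (I × ℤ) → Prop :=
  Relation.ReflTransGen (Move A)

/-- The underlying word of a decorated word. -/
abbrev word (L : List (I × ℤ)) : List I := L.map Prod.fst

lemma exists_of_word_eq_append {L : List (I × ℤ)} {l : List I} {i : I} (h : word L = l ++ [i]) :
    ∃ L' a, L = L' ++ [(i, a)] ∧ word L' = l := by
  obtain ⟨L', L'', rfl, h₁, h₂⟩ := List.map_eq_append_iff.1 h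
  obtain ⟨⟨_, a⟩, rfl, rfl⟩ := List.map_eq_singleton_iff.1 h₂
  exact ⟨L', a, rfl, h₁⟩

lemma exists_of_word_eq_cons {L : List (I × ℤ)} {l : List I} {i : I} (h : word L = i :: l) :
    ∃ a L', L = (i, a) :: L' ∧ word L' = l := by
  obtain ⟨⟨_, a⟩, L', rfl, rfl, h₁⟩ := List.map_eq_cons_iff.1 h
  exact ⟨a, L', rfl, h₁⟩

lemma Move.append {L L' : List (I × ℤ)} (h : Move A L L') (u v : List (I × ℤ)) :
    Move A (u ++ L ++ v) (u ++ L' ++ v) := by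
  cases h with
  | comm u' v' i j a b h => simpa using Move.comm (u ++ u') (v' ++ v) i j a b h
  | braid u' v' i j a b c h => simpa using Move.braid (u ++ u') (v' ++ v) i j a b c h

lemma Moves.append {L L' : List (I × ℤ)} (h : Moves A L L') (u v : List (I × ℤ)) :
    Moves A (u ++ L ++ v) (u ++ L' ++ v) :=
  Relation.ReflTransGen.lift (fun L => u ++ L ++ v) (fun _ _ h => h.append u v) _ _ h

lemma Moves.append_right {L L' : List (I × ℤ)} (h : Moves A L L') (v : List (I × ℤ)) :
    Moves A (L ++ v) (L' ++ v) := h.append [] v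

lemma Move.length_eq {L L' : List (I × ℤ)} (h : Move A L L') : L'.length = L.length := by
  cases h <;> simp

lemma Move.act_eq (hA : IsSimplyLacedCartan A) {L L' : List (I × ℤ)} (h : Move A L L') :
    act A (word L') = act A (word L) := by
  cases h with
  | comm u v i j a b h =>
    have e := congrArg (· * act A (word v)) (hA.reflection_comm h)
    simpa [mul_assoc] using congrArg (act A (word u) * ·) e.symm
  | braid u v i j a b c h =>
    have e := congrArg (· * act A (word v)) (hA.reflection_braid h)
    simpa [mul_assoc] using congrArg (act A (word u) * ·) e.symm

/-- Every decoration of the word `l` can be moved to a decoration of the word `l'`. -/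
def WordMoves (A : Matrix I I ℤ) (l l' : List I) : Prop :=
  ∀ L, word L = l → ∃ L', word L' = l' ∧ Moves A L L'

namespace WordMoves

lemma refl (l : List I) : WordMoves A l l := fun L hL => ⟨L, hL, .refl⟩

lemma trans {l₁ l₂ l₃ : List I} (h : WordMoves A l₁ l₂) (h' : WordMoves A l₂ l₃) :
    WordMoves A l₁ l₃ := fun L hL => by
  obtain ⟨L', hL', hm⟩ := h L hL
  obtain ⟨L'', hL'', hm'⟩ := h' L' hL'
  exact ⟨L'', hL'', hm.trans hm'⟩

lemma append_right {l l' : List I} (h : WordMoves A l l') (m : List I) :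
    WordMoves A (l ++ m) (l' ++ m) := fun L hL => by
  obtain ⟨L₁, L₂, rfl, h₁, h₂⟩ := List.map_eq_append_iff.1 hL
  obtain ⟨L', hL', hm⟩ := h L₁ h₁
  exact ⟨L' ++ L₂, by simp [hL', h₂], hm.append_right L₂⟩

lemma comm {i j : I} (h : A i j = 0) (l : List I) :
    WordMoves A (l ++ [i] ++ [j]) (l ++ [j] ++ [i]) := fun L hL => by
  obtain ⟨L, b, rfl, h₁⟩ := exists_of_word_eq_append hL
  obtain ⟨L, a, rfl, rfl⟩ := exists_of_word_eq_append h₁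
  exact ⟨L ++ [(j, b), (i, a)], by simp, .single (by simpa using Move.comm L [] i j a b h)⟩

lemma braid {i j : I} (h : A i j = -1) (l : List I) :
    WordMoves A (l ++ [i] ++ [j] ++ [i]) (l ++ [j] ++ [i] ++ [j]) := fun L hL => by
  obtain ⟨L, c, rfl, h₁⟩ := exists_of_word_eq_append hL
  obtain ⟨L, b, rfl, h₂⟩ := exists_of_word_eq_append h₁
  obtain ⟨L, a, rfl, rfl⟩ := exists_of_word_eq_append h₂
  exact ⟨L ++ [(j, b + c - min a c), (i, min a c), (j, a + b - min a c)], by simp,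
    .single (by simpa using Move.braid L [] i j a b c h)⟩

end WordMoves

/-- Any two reduced words of the same element are connected by moves. -/
theorem wordMoves_of_act_eq (hA : IsSimplyLacedCartan A) {l l' : List I}
    (hl : IsReducedWord A l) (hact : act A l' = act A l) (hlen : l'.length = l.length) :
    WordMoves A l l' := by
  induction hn : l.length generalizing l l' with
  | zero =>
    obtain rfl := List.length_eq_zero_iff.1 hn
    obtain rfl := List.length_eq_zero_iff.1 (hlen.trans hn)
    exact .refl _
  | succ n ih =>
    have hl' : IsReducedWord A l' := hl.congr hact hlen
    obtain ⟨p, i, rfl⟩ : ∃ p i, l = p ++ [i] :=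
      ⟨_, _, (List.dropLast_append_getLast (List.ne_nil_of_length_eq_add_one hn)).symm⟩
    obtain ⟨p', j, rfl⟩ : ∃ p j, l' = p ++ [j] :=
      ⟨_, _, (List.dropLast_append_getLast
        (List.ne_nil_of_length_eq_add_one (hlen.trans hn))).symm⟩
    have hp := hl.of_append_left
    simp only [List.length_append, List.length_singleton] at hlen hn
    -- two words with the same last letter are handled by induction
    have key : ∀ {q q' : List I} {k : I}, IsReducedWord A (q ++ [k]) →
        act A (q' ++ [k]) = act A (q ++ [k]) → q'.length = q.length → q.length = n →
        WordMoves A (q ++ [k]) (q' ++ [k]) := fun h1 h2 h3 h4 =>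
      (ih h1.of_append_left (hA.act_append_singleton_inj h2) h3 h4).append_right _
    rcases eq_or_ne i j with rfl | hij
    · exact key hl hact (by omega) (by omega)
    have hwi := hl.nonpos hA
    have hwj := hl'.nonpos hA
    rw [hact] at hwj
    have hpe : ∀ x, act A p x = act A (p ++ [i]) (reflection A i x) := fun x => by
      simp [hA.reflection_reflection]
    rcases hA.offDiag i j hij with h0 | h1
    · obtain ⟨q, hqlen, hqact, hq⟩ := hp.exists_append_singleton hA (j := j) (by
        rw [hpe, reflection_simple, h0]; simpa using hwj)
      simp only [List.length_append, List.length_singleton] at hqlen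
      have e1 : act A (q ++ [j] ++ [i]) = act A (p ++ [i]) := by
        rw [act_append, hqact, act_append]
      have e2 : act A (q ++ [i] ++ [j]) = act A (p ++ [i]) := by
        rw [← e1]; simp [hA.reflection_comm h0]
      have s1 := key hl e1 (by simp; omega) (by omega)
      have s2 := WordMoves.comm (by rw [hA.symm, h0]) q (A := A) (i := j) (j := i)
      have s3 := key (hl.congr e2 (by simp; omega)) (hact.trans e2.symm)
        (by simp; omega) (by simp; omega)
      exact (s1.trans s2).trans s3
    · have h1' : A j i = -1 := by rw [hA.symm, h1]
      obtain ⟨q, hqlen, hqact, hq⟩ := hp.exists_append_singleton hA (j := j) (by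
        rw [hpe, reflection_simple, h1]
        simpa using add_nonpos hwj hwi)
      have hqe : act A q (simpleRoot i) = act A (p ++ [i]) (simpleRoot j) := by
        rw [← hA.act_append_append_self q j, act_append, hqact, act_append]
        simp [reflection_simple, h1, h1', add_comm]
      obtain ⟨r, hrlen, hract, hr⟩ := hq.of_append_left.exists_append_singleton hA (j := i)
        (by rw [hqe]; exact hwj)
      simp only [List.length_append, List.length_singleton] at hqlen hrlen
      have e1 : act A (r ++ [i] ++ [j] ++ [i]) = act A (p ++ [i]) := by
        rw [act_append, act_append (r ++ [i]), hract, ← act_append, hqact, act_append]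
      have e2 : act A (r ++ [j] ++ [i] ++ [j]) = act A (p ++ [i]) := by
        rw [← e1]; simp [← hA.reflection_braid h1]
      have s1 := key hl e1 (by simp; omega) (by omega)
      have s2 := WordMoves.braid h1 r
      have s3 := key (hl.congr e2 (by simp; omega)) (hact.trans e2.symm)
        (by simp; omega) (by simp; omega)
      exact (s1.trans s2).trans s3

lemma act_nonpos {l : List I} (h : ∀ j, act A l (simpleRoot j) ≤ 0) {x : I → ℤ} (hx : 0 ≤ x) :
    act A l x ≤ 0 := by
  have e : x = ∑ j, x j • simpleRoot j := by
    funext k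
    simp [simpleRoot, Finset.sum_apply, Pi.single_apply]
  rw [e, map_sum]
  refine Finset.sum_nonpos fun j _ => ?_
  rw [map_smul]
  exact smul_nonpos_of_nonneg_of_nonpos (hx j) (h j)

/-- If `p ++ t` is a reduced word of the longest element and `p ++ [i]` is reduced, then `t` may
be replaced by a word starting with `i`. -/
lemma exists_cons_of_nonneg (hA : IsSimplyLacedCartan A) {p t : List I} {i : I}
    (ht : IsReducedWord A t) (hlong : ∀ j, act A (p ++ t) (simpleRoot j) ≤ 0)
    (hi : 0 ≤ act A p (simpleRoot i)) :
    ∃ t' : List I, (i :: t').length = t.length ∧ act A (i :: t') = act A t := by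
  have hneg : act A t.reverse (simpleRoot i) ≤ 0 := by
    rw [← hA.act_simple_not_nonneg_iff]
    intro hpos
    refine (hA.act_simple_not_nonneg_iff p i).2 ?_ hi
    have h := act_nonpos hlong hpos
    rwa [act_append, Module.End.mul_apply, ← Module.End.mul_apply (act A t), hA.act_mul_reverse,
      Module.End.one_apply] at h
  obtain ⟨m, hlen, hact, -⟩ := (ht.reverse hA).exists_append_singleton hA hneg
  exact ⟨m.reverse, by simpa using hlen, by simpa using hA.act_reverse_congr hact⟩

/-- In a family of decorations of reduced words of the longest element which is closed under moves,
has nonnegative decorations, and has first decorations bounded by `n`, the `k`-th decorations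
(counted from `0`) are bounded by `2 ^ k * n`. -/
theorem decoration_le (hA : IsSimplyLacedCartan A) {P : List (I × ℤ) → Prop} {n : ℕ}
    (hmove : ∀ L L', P L → Move A L L' → P L')
    (hred : ∀ L, P L → IsReducedWord A (word L))
    (hlong : ∀ L, P L → ∀ j, act A (word L) (simpleRoot j) ≤ 0)
    (hnonneg : ∀ L, P L → ∀ x ∈ L, 0 ≤ x.2)
    (hfirst : ∀ x L, P (x :: L) → x.2 ≤ n)
    (p t : List (I × ℤ)) (x : I × ℤ) (hP : P (p ++ [x] ++ t)) : x.2 ≤ 2 ^ p.length * n := by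
  have hmoves : ∀ L L', P L → Moves A L L' → P L' := fun L L' h hm => by
    induction hm with
    | refl => exact h
    | tail _ hs ih => exact hmove _ _ ih hs
  induction hN : p.length using Nat.strong_induction_on generalizing p t x with
  | _ N ih =>
  rcases List.eq_nil_or_concat' p with rfl | ⟨p, ⟨i, y⟩, rfl⟩
  · subst hN
    simpa using hfirst x t (by simpa using hP)
  obtain ⟨j, c⟩ := x
  obtain rfl : N = p.length + 1 := by simpa using hN.symm
  have hstep : (2 : ℤ) ^ p.length * n ≤ 2 ^ (p.length + 1) * n := by
    gcongr <;> simp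
  have hr := hred _ hP
  have hr' : IsReducedWord A (word p ++ [i] ++ [j]) := by
    have : word (p ++ [(i, y)] ++ [(j, c)] ++ t) = (word p ++ [i] ++ [j]) ++ word t := by simp
    rw [this] at hr
    exact hr.of_append_left
  have hij : i ≠ j := by
    rintro rfl
    have := hr' (word p) (hA.act_append_append_self _ _).symm
    simp at this
  rcases hA.offDiag i j hij with h0 | h1
  · have hP' : P (p ++ [(j, c)] ++ ((i, y) :: t)) :=
      hmove _ _ hP (by simpa using Move.comm p t i j y c h0)
    exact (ih _ (Nat.lt_succ_self _) p _ _ hP' rfl).trans hstep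
  have h1' : A j i = -1 := by rw [hA.symm, h1]
  by_cases hpos : 0 ≤ act A (word p) (simpleRoot j)
  · have hi : 0 ≤ act A (word (p ++ [(i, y)] ++ [(j, c)])) (simpleRoot i) := by
      simpa [reflection_simple, hA.reflection_simple_self, h1, h1'] using hpos
    have hlt := hlong _ hP
    rw [word, List.map_append] at hr hlt
    obtain ⟨t', hlen, hact⟩ := exists_cons_of_nonneg hA hr.of_append_right hlt hi
    obtain ⟨T, hT, hm⟩ := wordMoves_of_act_eq hA hr.of_append_right hact hlen _ rfl
    obtain ⟨z, T', rfl, -⟩ := exists_of_word_eq_cons hT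
    have hP' := hmoves _ _ hP (by simpa using hm.append (p ++ [(i, y)] ++ [(j, c)]) [])
    have hP'' : P (p ++ [(j, c + z - min y z)] ++ ((i, min y z) :: (j, y + c - min y z) :: T')) :=
      hmove _ _ hP' (by simpa using Move.braid p T' i j y c z h1)
    have := ih _ (Nat.lt_succ_self _) p _ _ hP'' rfl
    have := min_le_right y z
    simp only at *
    omega
  · have hp : IsReducedWord A (word p) := hr'.of_append_left.of_append_left
    obtain ⟨q, hlen, hact, -⟩ := hp.exists_append_singleton hA
      ((hA.act_simple_not_nonneg_iff _ _).1 hpos)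
    obtain ⟨Q, hQ, hm⟩ := wordMoves_of_act_eq hA hp hact hlen _ rfl
    obtain ⟨Q, z, rfl, rfl⟩ := exists_of_word_eq_append hQ
    have hlen : p.length = Q.length + 1 := by simpa using hlen.symm
    have hP' := hmoves _ _ hP (by simpa using hm.append_right ((i, y) :: (j, c) :: t))
    have hP'' : P (Q ++ [(i, y + c - min z c)] ++ ((j, min z c) :: (i, z + y - min z c) :: t)) :=
      hmove _ _ hP' (by simpa using Move.braid Q t j i z y c h1')
    have b1 := ih Q.length (by omega) Q _ _ hP'' rfl
    have b2 := ih Q.length (by omega) Q ((i, y) :: (j, c) :: t) _ (by simpa using hP') rfl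
    have b3 := hnonneg _ hP (i, y) (by simp)
    have b4 := min_le_left z c
    have b5 : (2 : ℤ) ^ (p.length + 1) * n = 4 * (2 ^ Q.length * n) := by rw [hlen]; ring
    have b6 : (0 : ℤ) ≤ 2 ^ Q.length * n := by positivity
    simp only at *
    omega

lemma getElem?_append_pair_append {α : Type*} (u v : List α) (x y x' y' : α) {k : ℕ}
    (h0 : k ≠ u.length) (h1 : k ≠ u.length + 1) :
    (u ++ [x, y] ++ v)[k]? = (u ++ [x', y'] ++ v)[k]? := by
  grind

lemma getElem?_append_triple_append {α : Type*} (u v : List α) (x y z x' y' z' : α) {k : ℕ}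
    (h0 : k ≠ u.length) (h1 : k ≠ u.length + 1) (h2 : k ≠ u.length + 2) :
    (u ++ [x, y, z] ++ v)[k]? = (u ++ [x', y', z'] ++ v)[k]? := by
  grind

/-- The decorated word attached to a pair of families. -/
def toWord {ν : ℕ} (q : (Fin ν → I) × (Fin ν → ℤ)) : List (I × ℤ) :=
  List.ofFn fun k => (q.1 k, q.2 k)

lemma word_toWord {ν : ℕ} (q : (Fin ν → I) × (Fin ν → ℤ)) : word (toWord q) = List.ofFn q.1 := by
  simp [word, toWord, List.map_ofFn, Function.comp_def]

lemma exists_toWord_eq {ν : ℕ} {L : List (I × ℤ)} (h : L.length = ν) :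
    ∃ q : (Fin ν → I) × (Fin ν → ℤ), toWord q = L := by
  subst h
  exact ⟨(fun k => (L[k]).1, fun k => (L[k]).2), by simp [toWord]⟩

lemma toWord_getElem? {ν : ℕ} (q : (Fin ν → I) × (Fin ν → ℤ)) (k : ℕ) (hk : k < ν) :
    (toWord q)[k]? = some (q.1 ⟨k, hk⟩, q.2 ⟨k, hk⟩) := by
  simp [toWord, hk]

lemma mem_redWord_iff {w₀ : Function.End (I → ℤ)} {ν : ℕ} {f g : Fin ν → I}
    (hf : f ∈ RedWord A w₀ ν) :
    g ∈ RedWord A w₀ ν ↔ act A (List.ofFn g) = act A (List.ofFn f) := by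
  rw [← prod_map_sE_eq_iff, show ((List.ofFn f).map (sE A)).prod = w₀ from hf]
  rfl

/-- A move on the decorated words is an adjacency. -/
lemma tAdjacent_of_move (hA : IsSimplyLacedCartan A) {w₀ : Function.End (I → ℤ)} {ν : ℕ}
    {q q' : (Fin ν → I) × (Fin ν → ℤ)} (hq : q.1 ∈ RedWord A w₀ ν)
    (h : Move A (toWord q) (toWord q')) : TAdjacent A w₀ ν q q' := by
  have hq' : q'.1 ∈ RedWord A w₀ ν := by
    rw [mem_redWord_iff hq, ← word_toWord, ← word_toWord, h.act_eq hA]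
  refine ⟨hq, hq', ?_⟩
  generalize hL : toWord q = L at h
  generalize hL' : toWord q' = L' at h
  have hlen : ν = L.length := by simp [← hL, toWord]
  have e : ∀ k (hk : k < ν), L[k]? = some (q.1 ⟨k, hk⟩, q.2 ⟨k, hk⟩) := fun k hk => by
    rw [← hL, toWord_getElem?]
  have e' : ∀ k (hk : k < ν), L'[k]? = some (q'.1 ⟨k, hk⟩, q'.2 ⟨k, hk⟩) := fun k hk => by
    rw [← hL', toWord_getElem?]
  cases h with
  | comm u v i j a b h =>
    simp only [List.length_append, List.length_cons, List.length_nil] at hlen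
    refine .inr ⟨u.length, by omega, by omega, ?_⟩
    have e0 := e u.length (by omega)
    have e1 := e (u.length + 1) (by omega)
    have e0' := e' u.length (by omega)
    have e1' := e' (u.length + 1) (by omega)
    simp at e0 e1 e0' e1'
    refine ⟨by rw [← e0.1, ← e1.1, h], by rw [← e0'.1, ← e1.1], by rw [← e1'.1, ← e0.1], ?_,
      by rw [← e0'.2, ← e1.2], by rw [← e1'.2, ← e0.2]⟩
    intro k h0 h1
    have := e' k k.2
    rw [getElem?_append_pair_append u v _ _ (i, a) (j, b) h0 h1, e k k.2] at this
    simpa [eq_comm] using this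
  | braid u v i j a b c h =>
    simp only [List.length_append, List.length_cons, List.length_nil] at hlen
    refine .inl ⟨u.length, by omega, by omega, by omega, ?_⟩
    have e0 := e u.length (by omega)
    have e1 := e (u.length + 1) (by omega)
    have e2 := e (u.length + 2) (by omega)
    have e0' := e' u.length (by omega)
    have e1' := e' (u.length + 1) (by omega)
    have e2' := e' (u.length + 2) (by omega)
    simp at e0 e1 e2 e0' e1' e2'
    refine ⟨by rw [← e0.1, ← e1.1, h], by rw [← e2.1, ← e0.1], by rw [← e0'.1, ← e1.1],
      by rw [← e1'.1, ← e0.1], by rw [← e2'.1, ← e1.1], ?_,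
      by rw [← e0'.2, ← e1.2, ← e2.2, ← e0.2], by rw [← e1'.2, ← e2.2, ← e0.2],
      by rw [← e2'.2, ← e1.2, ← e2.2, ← e0.2]⟩
    intro k h0 h1 h2
    have := e' k k.2
    rw [getElem?_append_triple_append u v _ _ _ (i, a) (j, b) (i, c) h0 h1 h2, e k k.2] at this
    simpa [eq_comm] using this

lemma IsLongest.isReducedWord {w₀ : Function.End (I → ℤ)} {ν : ℕ} (hw : IsLongest A w₀ ν)
    {f : Fin ν → I} (hf : f ∈ RedWord A w₀ ν) : IsReducedWord A (List.ofFn f) := by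
  intro l hl
  rw [List.length_ofFn, ← hw.len_eq]
  refine Nat.sInf_le ⟨l, rfl, ?_⟩
  rw [(prod_map_sE_eq_iff _ _).2 hl]
  exact hf

lemma IsLongest.act_simple_nonpos (hA : IsSimplyLacedCartan A) {w₀ : Function.End (I → ℤ)} {ν : ℕ}
    (hw : IsLongest A w₀ ν) {f : Fin ν → I} (hf : f ∈ RedWord A w₀ ν) (j : I) :
    act A (List.ofFn f) (simpleRoot j) ≤ 0 := by
  rw [← hA.act_simple_not_nonneg_iff]
  intro hj
  have hred := (hw.isReducedWord hf).append_singleton hA hj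
  have hle := hw.longest (((List.ofFn f ++ [j]).map (sE A)).prod) ⟨_, rfl⟩
  obtain ⟨l, hlen, hl⟩ := Nat.sInf_mem
    (s := {n | ∃ l : List I, l.length = n ∧
      (l.map (sE A)).prod = ((List.ofFn f ++ [j]).map (sE A)).prod}) ⟨_, _, rfl, rfl⟩
  have := hred l ((prod_map_sE_eq_iff _ _).1 hl)
  rw [hlen] at this
  have := this.trans hle
  simp at this

end RootSystem

/-- for fixed `f ∈ ℐ`, the set of `a ∈ ℤ^ν` whose class lies in
`𝒰_ℕ^n` is finite, of cardinality at most `Π_{k=1}^{ν} (2^{k-1} n + 1)`. -/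
theorem card_bound (A : Matrix I I ℤ) (hA : IsSimplyLacedCartan A)
    (w₀ : Function.End (I → ℤ)) (ν : ℕ) (hw : IsLongest A w₀ ν)
    (n : ℕ) (f : Fin ν → I) (hf : f ∈ RedWord A w₀ ν) :
    {a : Fin ν → ℤ | ∀ q, Relation.EqvGen (TAdjacent A w₀ ν) (f, a) q →
      (∀ k : Fin ν, 0 ≤ q.2 k) ∧
      (∀ k : Fin ν, (k : ℕ) = 0 → q.2 k ≤ n)}.Finite ∧
    {a : Fin ν → ℤ | ∀ q, Relation.EqvGen (TAdjacent A w₀ ν) (f, a) q →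
      (∀ k : Fin ν, 0 ≤ q.2 k) ∧
      (∀ k : Fin ν, (k : ℕ) = 0 → q.2 k ≤ n)}.ncard
        ≤ ∏ k : Fin ν, (2 ^ (k : ℕ) * n + 1) := by
  have hsub : {a : Fin ν → ℤ | ∀ q, Relation.EqvGen (TAdjacent A w₀ ν) (f, a) q →
      (∀ k : Fin ν, 0 ≤ q.2 k) ∧ (∀ k : Fin ν, (k : ℕ) = 0 → q.2 k ≤ n)} ⊆
      (Fintype.piFinset fun k : Fin ν => Finset.Icc (0 : ℤ) (2 ^ (k : ℕ) * n) :
        Finset (Fin ν → ℤ)) := by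
    intro a ha
    rw [Set.mem_ofPred_eq] at ha
    simp only [Finset.mem_coe, Fintype.mem_piFinset, Finset.mem_Icc]
    intro k
    refine ⟨(ha _ (.refl _)).1 k, ?_⟩
    let P : List (I × ℤ) → Prop := fun L => ∃ q, Relation.EqvGen (TAdjacent A w₀ ν) (f, a) q ∧
      q.1 ∈ RedWord A w₀ ν ∧ toWord q = L
    have hP : P (toWord (f, a)) := ⟨_, .refl _, hf, rfl⟩
    have hk : k < (toWord (f, a)).length := by simp [toWord]
    have hsplit : (toWord (f, a)).take k ++ [(toWord (f, a))[k]] ++ (toWord (f, a)).drop (k + 1) =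
        toWord (f, a) := by simp
    rw [← hsplit] at hP
    have := decoration_le hA (P := P) (n := n) ?_ ?_ ?_ ?_ ?_ _ _ _ hP
    · simpa [toWord] using this
    · rintro _ L' ⟨q, hq, hred, rfl⟩ hmove
      obtain ⟨q', rfl⟩ : ∃ q' : (Fin ν → I) × (Fin ν → ℤ), toWord q' = L' :=
        exists_toWord_eq (by rw [hmove.length_eq]; simp [toWord])
      have hadj := tAdjacent_of_move hA hred hmove
      exact ⟨q', hq.trans _ _ _ (.rel _ _ hadj), hadj.2.1, rfl⟩
    · rintro _ ⟨q, -, hred, rfl⟩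
      rw [word_toWord]
      exact hw.isReducedWord hred
    · rintro _ ⟨q, -, hred, rfl⟩ j
      rw [word_toWord]
      exact hw.act_simple_nonpos hA hred j
    · rintro _ ⟨q, hq, -, rfl⟩ x hx
      obtain ⟨m, rfl⟩ := List.mem_ofFn.1 hx
      exact (ha q hq).1 m
    · rintro x L ⟨q, hq, -, hL⟩
      have hν : 0 < ν := by
        have := congrArg List.length hL
        simp [toWord] at this
        omega
      have h0 := toWord_getElem? q 0 hν
      rw [hL] at h0
      obtain rfl : x = (q.1 ⟨0, hν⟩, q.2 ⟨0, hν⟩) := by simpa using h0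
      exact (ha q hq).2 _ rfl
  refine ⟨(Finset.finite_toSet _).subset hsub, ?_⟩
  refine (Set.ncard_le_ncard hsub (Finset.finite_toSet _)).trans_eq ?_
  rw [Set.ncard_coe_finset, Fintype.card_piFinset]
  refine Finset.prod_congr rfl fun k _ => ?_
  rw [Int.card_Icc, sub_zero]
  exact Int.toNat_natCast (2 ^ (k : ℕ) * n + 1)

end Lusztig
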